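/- The elliptic curve over Q given by the Weierstrass equation y^2 + y = x^3 + x^2 - 23846x + 1022562 (coefficients [a1,a2,a3,a4,a6] = [0,1,1,-23846,1022562]) has discriminant of absolute value 409086620841461, and its group of rational points contains 8 points that are linearly independent over Z (so the curve has Mordell–Weil rank at least 8). -/

import Mathlib

open Polynomial

section Characters

variable {A ι : Type*} [AddCommGroup A] [Fintype ι]

/-- In a group without `2`-torsion, points that are dual to quadratic characters are linearly
independent: every relation among them is divisible by all powers of `2`. -/
theorem linearIndependent_of_dual_characters [DecidableEq ι] (htors : ∀ a : A, a + a = 0 → a = 0)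
    (P : ι → A) (χ : ι → A →+ Additive ℤˣ)
    (hχ : ∀ i j, χ i (P j) = Additive.ofMul (if i = j then -1 else 1)) :
    LinearIndependent ℤ P := by
  have even_of_relation : ∀ c : ι → ℤ, ∑ j, c j • P j = 0 → ∀ i, (2 : ℤ) ∣ c i := by
    intro c hc i
    have h := congrArg (fun a => (χ i a).toMul) hc
    simp only [map_sum, map_zsmul, hχ, toMul_sum, toMul_zsmul, toMul_ofMul, map_zero,
      toMul_zero, ite_pow, one_zpow, Finset.prod_ite_eq, Finset.mem_univ, if_true] at h
    rcases Int.even_or_odd (c i) with he | ho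
    · exact he.two_dvd
    · rw [ho.neg_one_zpow] at h
      exact absurd h (by decide)
  have dvd_of_relation : ∀ n : ℕ, ∀ c : ι → ℤ, ∑ j, c j • P j = 0 → ∀ i, (2 : ℤ) ^ n ∣ c i := by
    intro n
    induction n with
    | zero => simp
    | succ n ih =>
      intro c hc i
      choose d hd using even_of_relation c hc
      have hd_rel : ∑ j, d j • P j = 0 := by
        apply htors
        rw [← hc, ← Finset.sum_add_distrib]
        exact Finset.sum_congr rfl fun j _ => by rw [hd j, two_mul, add_zsmul]
      rw [hd i, pow_succ']
      exact mul_dvd_mul_left _ (ih d hd_rel i)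
  rw [Fintype.linearIndependent_iff]
  intro c hc i
  by_contra hne
  obtain ⟨n, hn⟩ : FiniteMultiplicity 2 (c i) := Int.finiteMultiplicity_iff.mpr ⟨by decide, hne⟩
  exact hn (dvd_of_relation (n + 1) c hc i)

end Characters

namespace WeierstrassCurve.Affine

variable {F L : Type*} [Field F] [Field L] [Algebra F L] [DecidableEq F]

/-- The three points of intersection of a line with a Weierstrass curve satisfy a norm relation
with respect to every root of the `2`-torsion polynomial. -/
theorem four_mul_prod_sub_eq_sq (W : Affine F) {e : L}
    (he : aeval e W.twoTorsionPolynomial.toPoly = 0) {x₁ x₂ y₁ y₂ : F}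
    (h₁ : W.Equation x₁ y₁) (h₂ : W.Equation x₂ y₂) (hxy : ¬(x₁ = x₂ ∧ y₁ = W.negY x₂ y₂)) :
    ∃ z : L, 4 * ((algebraMap F L x₁ - e) * (algebraMap F L x₂ - e) *
      (algebraMap F L (W.addX x₁ x₂ (W.slope x₁ x₂ y₁ y₂)) - e)) = z ^ 2 := by
  have h := congrArg (aeval e) (addPolynomial_slope h₁ h₂ hxy)
  simp only [addPolynomial_eq, Cubic.toPoly, twoTorsionPolynomial, b₂, b₄, b₆] at h he
  generalize W.addX x₁ x₂ (W.slope x₁ x₂ y₁ y₂) = x₃ at h ⊢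
  generalize W.slope x₁ x₂ y₁ y₂ = ℓ at h
  simp only [map_neg, map_add, map_mul, map_pow, map_sub, map_one, aeval_X, aeval_C,
    map_ofNat] at h he
  refine ⟨2 * (algebraMap F L ℓ * (e - algebraMap F L x₁) + algebraMap F L y₁) +
    algebraMap F L W.a₁ * e + algebraMap F L W.a₃, ?_⟩
  linear_combination -4 * h - he

variable [NeZero (2 : L)]

/-- The `2`-descent homomorphism attached to a root `e` of the `2`-torsion polynomial outside the
base field, followed by a quadratic character `ψ` of the extension containing `e`. -/
noncomputable def descentHom (W : Affine F) (e : L)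
    (he : aeval e W.twoTorsionPolynomial.toPoly = 0) (hne : ∀ x : F, algebraMap F L x - e ≠ 0)
    (ψ : Lˣ →* ℤˣ) : W.Point →+ Additive ℤˣ :=
  AddMonoidHom.mk'
    (fun P => match P with
      | .zero => 0
      | .some x _ _ => Additive.ofMul (ψ (Units.mk0 _ (hne x))))
    (by
      rintro (_ | ⟨x₁, y₁, h₁⟩) (_ | ⟨x₂, y₂, h₂⟩)
      · rfl
      · rw [← Point.zero_def, zero_add]
        exact (zero_add _).symm
      · rw [← Point.zero_def, add_zero]
        exact (add_zero _).symm
      · by_cases hxy : x₁ = x₂ ∧ y₁ = W.negY x₂ y₂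
        · rw [Point.add_of_Y_eq hxy.1 hxy.2]
          obtain ⟨rfl, -⟩ := hxy
          exact (congrArg Additive.ofMul (Int.units_mul_self _)).symm
        · rw [Point.add_some hxy]
          obtain ⟨z, hz⟩ := four_mul_prod_sub_eq_sq W he h₁.1 h₂.1 hxy
          have two_ne : (2 : L) ≠ 0 := NeZero.ne 2
          set x₃ := W.addX x₁ x₂ (W.slope x₁ x₂ y₁ y₂)
          have z_ne : z ≠ 0 := by
            rintro rfl
            have : (4 : L) ≠ 0 := by
              rw [show (4 : L) = 2 * 2 by norm_num]; exact mul_ne_zero two_ne two_ne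
            exact mul_ne_zero this (mul_ne_zero (mul_ne_zero (hne x₁) (hne x₂)) (hne x₃))
              (by simpa using hz)
          have hsq : Units.mk0 _ (hne x₁) * Units.mk0 _ (hne x₂) * Units.mk0 _ (hne x₃) =
              (Units.mk0 z z_ne / Units.mk0 2 two_ne) ^ 2 := by
            ext
            simp only [Units.val_mul, Units.val_mk0, Units.val_pow_eq_pow_val,
              Units.val_div_eq_div_val]
            field_simp
            linear_combination hz
          have hψ := congrArg ψ hsq
          rw [map_mul, map_mul, map_pow, Int.units_sq, mul_eq_one_iff_eq_inv,
            Int.units_inv_eq_self] at hψ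
          exact congrArg Additive.ofMul hψ.symm)

theorem descentHom_some (W : Affine F) (e : L)
    (he : aeval e W.twoTorsionPolynomial.toPoly = 0) (hne : ∀ x : F, algebraMap F L x - e ≠ 0)
    (ψ : Lˣ →* ℤˣ) {x y : F} (h : W.Nonsingular x y) :
    descentHom W e he hne ψ (.some x y h) = Additive.ofMul (ψ (Units.mk0 _ (hne x))) :=
  rfl

/-- A curve whose `2`-torsion polynomial has no rational root has no rational `2`-torsion. -/
theorem eq_zero_of_add_self_eq_zero (W : Affine F)
    (hroot : ∀ x : F, W.twoTorsionPolynomial.toPoly.eval x ≠ 0) (P : W.Point) (hP : P + P = 0) :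
    P = 0 := by
  rcases P with _ | ⟨x, y, h⟩
  · rfl
  · by_cases hy : y = W.negY x y
    · refine absurd ?_ (hroot x)
      have heq := (W.equation_iff x y).mp h.1
      simp only [Cubic.toPoly, twoTorsionPolynomial, b₂, b₄, b₆, eval_add, eval_mul, eval_C,
        eval_pow, eval_X]
      rw [negY] at hy
      linear_combination (2 * y + W.a₁ * x + W.a₃) * hy - 4 * heq
    · rw [Point.add_self_of_Y_ne hy] at hP
      exact absurd hP (Point.some_ne_zero _)

end WeierstrassCurve.Affine

section Padic

variable (p : ℕ) [Fact p.Prime]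

theorem Padic.norm_mul_zpow_neg_valuation {x : ℚ_[p]} (hx : x ≠ 0) :
    ‖x * (p : ℚ_[p]) ^ (-x.valuation)‖ = 1 := by
  have hp : (p : ℝ) ≠ 0 := mod_cast (Fact.out : p.Prime).ne_zero
  rw [norm_mul, Padic.norm_p_zpow, neg_neg, Padic.norm_eq_zpow_neg_valuation hx,
    ← zpow_add₀ hp, neg_add_cancel, zpow_zero]

/-- The unit part `x * p ^ (-v x)` of a nonzero `p`-adic number. -/
noncomputable def Padic.unitPart : ℚ_[p]ˣ →* ℤ_[p]ˣ where
  toFun x := PadicInt.mkUnits (Padic.norm_mul_zpow_neg_valuation p x.ne_zero)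
  map_one' := by
    refine Units.ext (Subtype.ext ?_)
    change ((1 : ℚ_[p]ˣ) : ℚ_[p]) * _ = 1
    simp
  map_mul' x y := by
    have hp : (p : ℚ_[p]) ≠ 0 := mod_cast (Fact.out : p.Prime).ne_zero
    refine Units.ext (Subtype.ext ?_)
    change ((x * y : ℚ_[p]ˣ) : ℚ_[p]) * _ = (x * _) * (y * _)
    rw [Units.val_mul, Padic.valuation_mul x.ne_zero y.ne_zero, neg_add, zpow_add₀ hp]
    ring

/-- The quadratic character of the residue of the unit part of a nonzero `p`-adic number. -/
noncomputable def Padic.quadraticUnitChar : ℚ_[p]ˣ →* ℤˣ :=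
  (quadraticChar (ZMod p)).toUnitHom.comp
    ((Units.map (PadicInt.toZMod (p := p)).toMonoidHom).comp (Padic.unitPart p))

variable {p}

theorem PadicInt.norm_eq_one_iff_toZMod_ne_zero (z : ℤ_[p]) :
    ‖z‖ = 1 ↔ PadicInt.toZMod z ≠ 0 := by
  rw [← PadicInt.isUnit_iff, ne_eq, ← RingHom.mem_ker, PadicInt.ker_toZMod,
    IsLocalRing.mem_maximalIdeal, mem_nonunits_iff, not_not]

theorem Padic.quadraticUnitChar_eq {u : ℚ_[p]ˣ} {z : ℤ_[p]} (hu : (u : ℚ_[p]) = z)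
    (hz : PadicInt.toZMod z ≠ 0) :
    ((Padic.quadraticUnitChar p u : ℤˣ) : ℤ) = quadraticChar (ZMod p) (PadicInt.toZMod z) := by
  have hval : (u : ℚ_[p]).valuation = 0 := by
    have hnorm : ‖(u : ℚ_[p])‖ = 1 := by
      rw [hu]; exact (PadicInt.norm_eq_one_iff_toZMod_ne_zero z).mpr hz
    have hp : (1 : ℝ) < p := mod_cast (Fact.out : p.Prime).one_lt
    rw [Padic.norm_eq_zpow_neg_valuation u.ne_zero, zpow_eq_one_iff_right₀ (by linarith) hp.ne']
      at hnorm
    exact neg_eq_zero.mp hnorm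
  have hunit : (Padic.unitPart p u : ℤ_[p]) = z := by
    refine Subtype.ext ?_
    change (u : ℚ_[p]) * (p : ℚ_[p]) ^ (-(u : ℚ_[p]).valuation) = z
    rw [hval, neg_zero, zpow_zero, mul_one, hu]
  rw [← hunit]
  exact MulChar.coe_toUnitHom _ _

/-- Hensel's lemma for a simple root modulo `p` of an integral polynomial. -/
theorem PadicInt.exists_aeval_eq_zero (f : ℤ[X]) (r : ℤ) (hroot : (p : ℤ) ∣ f.eval r)
    (hsimple : ¬(p : ℤ) ∣ f.derivative.eval r) :
    ∃ e : ℤ_[p], aeval e f = 0 ∧ PadicInt.toZMod e = r := by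
  have aeval_int : ∀ g : ℤ[X], aeval (r : ℤ_[p]) g = ((g.eval r : ℤ) : ℤ_[p]) := fun g => by
    simpa using aeval_algebraMap_apply_eq_algebraMap_eval (A := ℤ_[p]) r g
  have hderiv : ‖aeval (r : ℤ_[p]) f.derivative‖ = 1 := by
    rw [aeval_int, PadicInt.norm_eq_one_iff_toZMod_ne_zero, map_intCast, ne_eq,
      ZMod.intCast_zmod_eq_zero_iff_dvd]
    exact hsimple
  have hval : ‖aeval (r : ℤ_[p]) f‖ < 1 := by
    rw [aeval_int]
    exact (PadicInt.norm_int_lt_one_iff_dvd _).mpr hroot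
  obtain ⟨e, he, hclose, -⟩ := hensels_lemma (F := f) (a := (r : ℤ_[p])) (by
    rw [hderiv]; simpa using hval)
  refine ⟨e, he, ?_⟩
  rw [hderiv] at hclose
  have hker := mt (PadicInt.norm_eq_one_iff_toZMod_ne_zero (e - (r : ℤ_[p]))).mpr hclose.ne
  rw [not_not, map_sub, map_intCast, sub_eq_zero] at hker
  exact hker

end Padic

namespace RankEightCurve

/-- The curve `y² + y = x³ + x² - 23846x + 1022562`. -/
def curve : WeierstrassCurve ℚ := ⟨0, 1, 1, -23846, 1022562⟩

/-- The `2`-torsion polynomial of `curve`, with integral coefficients. -/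
noncomputable def cubic : ℤ[X] := (⟨4, 4, -95384, 4090249⟩ : Cubic ℤ).toPoly

theorem twoTorsionPolynomial_eq :
    curve.twoTorsionPolynomial.toPoly = cubic.map (Int.castRingHom ℚ) := by
  rw [cubic, ← Cubic.map_toPoly]
  congr 1
  ext <;> norm_num [curve, Cubic.map, WeierstrassCurve.twoTorsionPolynomial,
    WeierstrassCurve.b₂, WeierstrassCurve.b₄, WeierstrassCurve.b₆]

theorem aeval_twoTorsionPolynomial {L : Type*} [Field L] [Algebra ℚ L] (e : L) :
    aeval e curve.twoTorsionPolynomial.toPoly = aeval e cubic := by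
  rw [twoTorsionPolynomial_eq]
  exact aeval_map_algebraMap ℚ e cubic

/-- The cubic has no rational root because it has none in the projective line over `𝔽₅`. -/
theorem eval_twoTorsionPolynomial_ne_zero (x : ℚ) :
    curve.twoTorsionPolynomial.toPoly.eval x ≠ 0 := by
  intro h
  rw [twoTorsionPolynomial_eq, cubic, ← Cubic.map_toPoly] at h
  simp only [Cubic.map, Cubic.toPoly, eval_add, eval_mul, eval_pow,
    eval_X, eval_C, eq_intCast] at h
  push_cast at h
  have hden : (x.den : ℚ) ≠ 0 := mod_cast x.den_nz
  have homog : 4 * x.num ^ 3 + 4 * x.num ^ 2 * x.den - 95384 * x.num * x.den ^ 2 +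
      4090249 * (x.den : ℤ) ^ 3 = 0 := by
    rw [← Rat.num_div_den x] at h
    field_simp at h
    have : (4 * x.num ^ 3 + 4 * x.num ^ 2 * x.den - 95384 * x.num * x.den ^ 2 +
      4090249 * (x.den : ℚ) ^ 3) = 0 := by linear_combination h
    exact_mod_cast this
  have no_root : ∀ a b : ZMod 5, 4 * a ^ 3 + 4 * a ^ 2 * b - 95384 * a * b ^ 2 +
      4090249 * b ^ 3 = 0 → a = 0 ∧ b = 0 := by decide
  have hmod := congrArg (Int.cast : ℤ → ZMod 5) homog
  push_cast at hmod
  obtain ⟨hnum, hden⟩ := no_root _ _ hmod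
  rw [ZMod.intCast_zmod_eq_zero_iff_dvd] at hnum
  rw [ZMod.natCast_eq_zero_iff] at hden
  have hgcd := Nat.dvd_gcd (Int.natCast_dvd.mp hnum) hden
  rw [x.reduced] at hgcd
  norm_num at hgcd

/-- A simple root `r` of the cubic modulo `p` gives a quadratic character of the group of rational
points, whose value at an integral point `(x, y)` is the Legendre symbol of `x - r`. -/
theorem exists_character (p : ℕ) [Fact p.Prime] (r : ℤ) (hroot : (p : ℤ) ∣ cubic.eval r)
    (hsimple : ¬(p : ℤ) ∣ cubic.derivative.eval r) :
    ∃ χ : curve.toAffine.Point →+ Additive ℤˣ,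
      ∀ (x y : ℤ) (h : curve.toAffine.Nonsingular (x : ℚ) y) (s : ℤˣ),
        legendreSym p (x - r) = s → χ (.some _ _ h) = Additive.ofMul s := by
  obtain ⟨e, he, her⟩ := PadicInt.exists_aeval_eq_zero cubic r hroot hsimple
  have he' : aeval (e : ℚ_[p]) curve.twoTorsionPolynomial.toPoly = 0 := by
    rw [aeval_twoTorsionPolynomial]
    have := aeval_algebraMap_apply ℚ_[p] e cubic
    rw [he, map_zero] at this
    exact this
  have hne : ∀ x : ℚ, algebraMap ℚ ℚ_[p] x - e ≠ 0 := by
    intro x hx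
    rw [← sub_eq_zero.mp hx, aeval_algebraMap_apply_eq_algebraMap_eval] at he'
    exact eval_twoTorsionPolynomial_ne_zero x ((map_eq_zero _).mp he')
  refine ⟨curve.toAffine.descentHom (e : ℚ_[p]) he' hne (Padic.quadraticUnitChar p), ?_⟩
  intro x y h s hs
  have hres : PadicInt.toZMod ((x : ℤ_[p]) - e) = ((x - r : ℤ) : ZMod p) := by
    rw [map_sub, map_intCast, her, Int.cast_sub]
  rw [WeierstrassCurve.Affine.descentHom_some]
  congr 1
  ext
  rw [Padic.quadraticUnitChar_eq (z := (x : ℤ_[p]) - e) (by simp)]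
  · rw [hres]
    exact hs
  · intro h0
    rw [legendreSym, ← hres, h0, MulChar.map_zero] at hs
    exact s.ne_zero hs.symm

/-- The `x`-coordinates of eight integral points. -/
def xCoord : Fin 8 → ℤ := ![-173, -170, -168, -135, -133, -102, -93, -62]

/-- The `y`-coordinates of eight integral points. -/
def yCoord : Fin 8 → ℤ := ![11, 438, 561, 1341, 1363, 1550, 1563, 1505]

theorem nonsingular (i : Fin 8) :
    curve.toAffine.Nonsingular (xCoord i : ℚ) (yCoord i) := by
  rw [WeierstrassCurve.Affine.nonsingular_iff, WeierstrassCurve.Affine.equation_iff]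
  fin_cases i <;> norm_num [curve, xCoord, yCoord]

/-- Eight integral points on the curve. -/
def point (i : Fin 8) : curve.toAffine.Point := .some _ _ (nonsingular i)

theorem exists_dual_character_of_legendreSym {p : ℕ} (hp : p.Prime) (r : ℤ)
    (hroot : (p : ℤ) ∣ 4 * r ^ 3 + 4 * r ^ 2 - 95384 * r + 4090249)
    (hsimple : ¬(p : ℤ) ∣ 12 * r ^ 2 + 8 * r - 95384) (i : Fin 8)
    (hsymb : ∀ j, haveI := Fact.mk hp
      legendreSym p (xCoord j - r) = if i = j then -1 else 1) :
    ∃ χ : curve.toAffine.Point →+ Additive ℤˣ,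
      ∀ j, χ (point j) = Additive.ofMul (if i = j then -1 else 1) := by
  have := Fact.mk hp
  obtain ⟨χ, hχ⟩ := exists_character p r (by
    convert hroot using 1
    simp only [cubic, Cubic.toPoly, eval_add, eval_mul, eval_pow, eval_X, eval_C]
    ring) (by
    convert hsimple using 2
    simp [cubic, Cubic.toPoly]
    ring)
  refine ⟨χ, fun j => hχ _ _ (nonsingular j) _ ?_⟩
  rw [hsymb j]
  split_ifs <;> rfl

/-- Each of the eight points is detected by a prime at which the other seven points are trivial. -/
theorem exists_dual_character (i : Fin 8) :
    ∃ χ : curve.toAffine.Point →+ Additive ℤˣ,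
      ∀ j, χ (point j) = Additive.ofMul (if i = j then -1 else 1) := by
  have of_prime (p : ℕ) (r : ℤ) (hp : p.Prime) := exists_dual_character_of_legendreSym hp r
  fin_cases i
  on_goal 1 => refine of_prime 967 393 (by norm_num) (by norm_num) (by norm_num) _ fun j => ?_
  on_goal 2 => refine of_prime 337 196 (by norm_num) (by norm_num) (by norm_num) _ fun j => ?_
  on_goal 3 => refine of_prime 1847 1233 (by norm_num) (by norm_num) (by norm_num) _ fun j => ?_
  on_goal 4 => refine of_prime 547 237 (by norm_num) (by norm_num) (by norm_num) _ fun j => ?_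
  on_goal 5 => refine of_prime 691 459 (by norm_num) (by norm_num) (by norm_num) _ fun j => ?_
  on_goal 6 => refine of_prime 2579 815 (by norm_num) (by norm_num) (by norm_num) _ fun j => ?_
  on_goal 7 => refine of_prime 1979 153 (by norm_num) (by norm_num) (by norm_num) _ fun j => ?_
  on_goal 8 => refine of_prime 11 5 (by norm_num) (by norm_num) (by norm_num) _ fun j => ?_
  all_goals
    fin_cases j <;> simp only [xCoord] <;> norm_num

theorem linearIndependent_point : LinearIndependent ℤ point := by
  choose χ hχ using exists_dual_character
  exact linearIndependent_of_dual_characters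
    (curve.toAffine.eq_zero_of_add_self_eq_zero eval_twoTorsionPolynomial_ne_zero) point χ hχ

end RankEightCurve

/-- The elliptic curve `[0, 1, 1, -23846, 1022562]` has discriminant of absolute value `409086620841461`,
and its group of rational points contains `8` points that are linearly independent
over `ℤ` (so its Mordell–Weil rank is at least `8`). -/
theorem rank8_low_discriminant_curve (W : WeierstrassCurve ℚ)
    (hW : W = ⟨0, 1, 1, -23846, 1022562⟩) :
    |W.Δ| = 409086620841461 ∧
      ∃ P : Fin 8 → W.toAffine.Point, LinearIndependent ℤ P := by
  subst hW
  refine ⟨?_, RankEightCurve.point, RankEightCurve.linearIndependent_point⟩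
  norm_num [WeierstrassCurve.Δ, WeierstrassCurve.b₂, WeierstrassCurve.b₄, WeierstrassCurve.b₆,
    WeierstrassCurve.b₈]
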